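/- arXiv:0907.2547 — 10 statements merged into one kernel-verified Lean document; each statement's English description precedes it below -/
import Mathlib

section
/- Let (X,G) be a transitive topological dynamical system. Then (X,G) has sensitive dependence on initial conditions if and only if every point of X is a sensitive point. -/
/-- A system `(X,G)` has sensitive dependence on initial conditions: there is `ε > 0`
such that every nonempty open set is expanded by some `g ∈ G` to diameter `> ε`. -/
def IsSensitive (G : Type*) [Group G] (X : Type*) [MetricSpace X] [MulAction G X] : Prop :=
  ∃ ε > (0 : ℝ), ∀ U : Set X, IsOpen U → U.Nonempty →
    ∃ g : G, ε < Metric.diam ((fun z : X => g • z) '' U)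

/-- `x` is an equicontinuous point of the system `(X,G)`. -/
def IsEqctsPt (G : Type*) [Group G] {X : Type*} [MetricSpace X] [MulAction G X] (x : X) : Prop :=
  ∀ ε > (0 : ℝ), ∃ δ > (0 : ℝ), ∀ y : X, dist x y < δ → ∀ g : G, dist (g • x) (g • y) < ε

/-- A sensitive system has no equicontinuous point. -/
theorem IsSensitive.not_isEqctsPt {G X : Type*} [Group G] [MetricSpace X] [MulAction G X]
    (hs : IsSensitive G X) (x : X) : ¬ IsEqctsPt G x := by
  obtain ⟨ε, hε, hs⟩ := hs
  intro hx
  obtain ⟨δ, hδ, hx⟩ := hx (ε / 2) (half_pos hε)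
  obtain ⟨g, hg⟩ := hs (Metric.ball x δ) Metric.isOpen_ball ⟨x, Metric.mem_ball_self hδ⟩
  refine hg.not_ge (Metric.diam_le_of_forall_dist_le hε.le ?_)
  rintro _ ⟨y, hy, rfl⟩ _ ⟨z, hz, rfl⟩
  have hxy := hx y (Metric.mem_ball'.1 hy) g
  have hxz := hx z (Metric.mem_ball'.1 hz) g
  have := dist_triangle_left (g • y) (g • z) (g • x)
  dsimp only
  linarith

/-- In a system that is not sensitive, every point with dense orbit is equicontinuous. -/
theorem isEqctsPt_of_dense_orbit {G X : Type*} [Group G] [MetricSpace X] [CompactSpace X]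
    [MulAction G X] (hcont : ∀ g : G, Continuous fun x : X => g • x)
    (hs : ¬ IsSensitive G X) {x : X} (hx : Dense (MulAction.orbit G x)) : IsEqctsPt G x := by
  intro ε hε
  have hU : ∃ U : Set X, IsOpen U ∧ U.Nonempty ∧
      ∀ g : G, Metric.diam ((fun z : X => g • z) '' U) ≤ ε / 2 := by
    by_contra! h
    exact hs ⟨ε / 2, half_pos hε, h⟩
  obtain ⟨U, hUo, hUne, hdiam⟩ := hU
  obtain ⟨_, ⟨h, rfl⟩, hxU⟩ := hx.exists_mem_open hUo hUne
  obtain ⟨δ, hδ, hball⟩ := Metric.isOpen_iff.1 (hUo.preimage (hcont h)) x hxU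
  refine ⟨δ, hδ, fun y hy g => ?_⟩
  have hyU : h • y ∈ U := hball (Metric.mem_ball'.2 hy)
  have hd := Metric.dist_le_diam_of_mem
    (Metric.isBounded_of_compactSpace (s := (fun z : X => (g * h⁻¹) • z) '' U))
    (Set.mem_image_of_mem _ hxU) (Set.mem_image_of_mem _ hyU)
  simp only [smul_smul, inv_mul_cancel_right] at hd
  linarith [hdiam (g * h⁻¹)]

/-- A transitive system is sensitive iff every point is a sensitive point. -/
theorem transitive_sensitive_iff_forall_sensitive_point
    {G X : Type*} [Group G] [MetricSpace X] [CompactSpace X] [MulAction G X]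
    (hcont : ∀ g : G, Continuous fun x : X => g • x)
    (htrans : ∃ x : X, Dense (MulAction.orbit G x)) :
    IsSensitive G X ↔ ∀ x : X, ¬ IsEqctsPt G x := by
  obtain ⟨x, hx⟩ := htrans
  refine ⟨fun hs => hs.not_isEqctsPt, fun h => ?_⟩
  by_contra hs
  exact h x (isEqctsPt_of_dense_orbit hcont hs hx)
end

section
/- Let G be an infinite group and let L ⊆ G be symmetric, i.e., L = L⁻¹. If L is a Δ* set, then L is left syndetic. (Equivalently, in contrapositive form: if a symmetric set L ⊆ G is not left syndetic, then there is an infinite set S ⊆ G with {st⁻¹ : s,t ∈ S, s ≠ t} ∩ L = ∅.) -/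
/-- A Δ set in a group `G`: a set containing `{s * t⁻¹ : s, t ∈ S, s ≠ t}` for some
infinite `S ⊆ G`. -/
def IsDelta {G : Type*} [Group G] (A : Set G) : Prop :=
  ∃ S : Set G, S.Infinite ∧ {x : G | ∃ s ∈ S, ∃ t ∈ S, s ≠ t ∧ x = s * t⁻¹} ⊆ A

/-- A Δ* set: a set intersecting every Δ set. -/
def IsDeltaStar {G : Type*} [Group G] (A : Set G) : Prop :=
  ∀ B : Set G, IsDelta B → (A ∩ B).Nonempty

/-- `R ⊆ G` is left syndetic: `F * R = G` for some finite `F`. -/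
def LeftSyndetic {G : Type*} [Group G] (R : Set G) : Prop :=
  ∃ F : Finset G, ∀ g : G, ∃ f ∈ F, ∃ r ∈ R, g = f * r

/-- A symmetric Δ* set in an infinite group is left syndetic. -/
theorem symmetric_deltaStar_leftSyndetic
    {G : Type*} [Group G] [Infinite G] (L : Set G)
    (hsym : L⁻¹ = L) (hL : IsDeltaStar L) :
    LeftSyndetic L := by
  classical
  obtain ⟨x, hx, -⟩ := hL Set.univ ⟨Set.univ, Set.infinite_univ, Set.subset_univ _⟩
  by_contra hsynd
  simp only [LeftSyndetic, not_exists, not_forall, not_and] at hsynd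
  let r : G → G → Prop := fun s t => s ≠ t ∧ s * t⁻¹ ∉ L
  have inv_mem (y : G) (hy : y ∈ L) : y⁻¹ ∈ L := by
    rw [← hsym]
    simpa using hy
  have : Std.Symm r := ⟨fun s t h =>
    ⟨h.1.symm, fun ht => h.2 (by simpa using inv_mem _ ht)⟩⟩
  obtain ⟨f, -, hf⟩ := exists_seq_of_forall_finset_exists' (fun _ : G => True) r (by
    intro T _
    obtain ⟨h, hh⟩ := hsynd (T.image (fun t => t⁻¹) ∪ T.image (fun t => t⁻¹ * x⁻¹))
    refine ⟨h⁻¹, trivial, fun t ht => ⟨?_, fun hmem => ?_⟩⟩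
    · rintro rfl
      exact hh _ (Finset.mem_union_right _ (Finset.mem_image_of_mem _ ht)) x hx (by simp)
    · exact hh _ (Finset.mem_union_left _ (Finset.mem_image_of_mem _ ht)) _ hmem (by simp))
  have hinj : Function.Injective f := fun m n hmn => by
    by_contra hne
    exact (hf hne).1 hmn
  obtain ⟨_, hy, _, ⟨m, rfl⟩, _, ⟨n, rfl⟩, hne, rfl⟩ :=
    hL _ ⟨Set.range f, Set.infinite_range_of_injective hinj, subset_rfl⟩
  exact (hf (fun hmn => hne (congrArg f hmn))).2 hy
end

section
/- Let (X,G) be a topological dynamical system with an equicontinuous point x. If y ∈ X and there is a sequence g_n ∈ G with g_n·y → x, then y is also an equicontinuous point and the orbit closures of x and y coincide: closure(G·x) = closure(G·y). -/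
/-- If every group element acts continuously, a point in an orbit closure has its whole orbit
closure contained in it. -/
theorem closure_orbit_subset_of_mem_closure_orbit
    {G X : Type*} [Group G] [TopologicalSpace X] [MulAction G X]
    (hcont : ∀ g : G, Continuous fun x : X => g • x) {a b : X}
    (h : a ∈ closure (MulAction.orbit G b)) :
    closure (MulAction.orbit G a) ⊆ closure (MulAction.orbit G b) := by
  refine closure_minimal ?_ isClosed_closure
  rintro _ ⟨k, rfl⟩
  refine map_mem_closure (hcont k) h ?_
  rintro _ ⟨l, rfl⟩
  exact ⟨k * l, mul_smul k l b⟩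

/-- If `x` is an equicontinuous point and `g_n • y → x`, then `y` is also an
equicontinuous point with the same orbit closure as `x`. -/
theorem eqctsPt_inheritance
    {G X : Type*} [Group G] [MetricSpace X] [CompactSpace X] [MulAction G X]
    (hcont : ∀ g : G, Continuous fun x : X => g • x)
    {x y : X} (hx : IsEqctsPt G x) (g : ℕ → G)
    (hg : Filter.Tendsto (fun n => g n • y) Filter.atTop (nhds x)) :
    IsEqctsPt G y ∧ closure (MulAction.orbit G x) = closure (MulAction.orbit G y) := by
  have near : ∀ δ > (0 : ℝ), ∃ n, dist x (g n • y) < δ := fun δ hδ => by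
    obtain ⟨n, hn⟩ := (hg.eventually (Metric.ball_mem_nhds x hδ)).exists
    exact ⟨n, Metric.mem_ball'.mp hn⟩
  refine ⟨fun ε hε => ?_, Set.Subset.antisymm ?_ ?_⟩
  · obtain ⟨δ, hδ, hxδ⟩ := hx (ε / 2) (half_pos hε)
    obtain ⟨n, hn⟩ := near δ hδ
    obtain ⟨η, hη, hball⟩ := Metric.mem_nhds_iff.mp
      ((hcont (g n)).continuousAt.preimage_mem_nhds
        (Metric.isOpen_ball.mem_nhds (Metric.mem_ball'.mpr hn)))
    refine ⟨η, hη, fun z hz h => ?_⟩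
    have hz' : dist x (g n • z) < δ :=
      Metric.mem_ball'.mp (hball (Metric.mem_ball'.mpr hz))
    have hy₁ := hxδ _ hn (h * (g n)⁻¹)
    have hz₁ := hxδ _ hz' (h * (g n)⁻¹)
    rw [smul_smul, inv_mul_cancel_right] at hy₁ hz₁
    linarith [dist_triangle_left (h • y) (h • z) ((h * (g n)⁻¹) • x)]
  · exact closure_orbit_subset_of_mem_closure_orbit hcont
      (mem_closure_of_tendsto hg (.of_forall fun n => ⟨g n, rfl⟩))
  · refine closure_orbit_subset_of_mem_closure_orbit hcont
      (Metric.mem_closure_iff.mpr fun ε hε => ?_)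
    obtain ⟨δ, hδ, hxδ⟩ := hx ε hε
    obtain ⟨n, hn⟩ := near δ hδ
    refine ⟨(g n)⁻¹ • x, ⟨_, rfl⟩, ?_⟩
    have := hxδ _ hn (g n)⁻¹
    rwa [inv_smul_smul, dist_comm] at this
end

section
/- Let (X,G) be a topological dynamical system with a transitive point x. The following are equivalent: (1) (X,G) is almost equicontinuous; (2) x is an equicontinuous point; (3) for every ε > 0 there exists δ > 0 such that for all g, h ∈ G, d(h·x, x) < δ implies d(gh·x, g·x) < ε; (4) the metrics d and d_∞ induce the same topology on the set of transitive points of X. -/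
/-- The metric `d_∞(x,y) = sup_{g ∈ G} d(g • x, g • y)`. -/
noncomputable def dInfty (G : Type*) [Group G] {X : Type*} [MetricSpace X] [MulAction G X]
    (x y : X) : ℝ :=
  ⨆ g : G, dist (g • x) (g • y)

theorem dist_smul_le_dInfty {G X : Type*} [Group G] [MetricSpace X] [CompactSpace X]
    [MulAction G X] (g : G) (x y : X) : dist (g • x) (g • y) ≤ dInfty G x y := by
  refine le_ciSup (f := fun g : G => dist (g • x) (g • y)) ⟨Metric.diam (Set.univ : Set X), ?_⟩ g
  rintro _ ⟨k, rfl⟩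
  exact Metric.dist_le_diam_of_mem isCompact_univ.isBounded (Set.mem_univ _) (Set.mem_univ _)

/-- If a system has an equicontinuous point, then every transitive point is equicontinuous. -/
theorem IsEqctsPt.of_dense_orbit {G X : Type*} [Group G] [MetricSpace X] [MulAction G X]
    (hcont : ∀ g : G, Continuous fun x : X => g • x) {z w : X} (hz : IsEqctsPt G z)
    (hw : Dense (MulAction.orbit G w)) : IsEqctsPt G w := by
  intro ε hε
  obtain ⟨δ, hδ, hzδ⟩ := hz (ε / 2) (half_pos hε)
  obtain ⟨_, ⟨h, rfl⟩, hh⟩ := hw.exists_dist_lt z hδ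
  have hopen : IsOpen {y : X | dist z (h • y) < δ} :=
    isOpen_lt (continuous_const.dist (hcont h)) continuous_const
  obtain ⟨η, hη, hball⟩ := Metric.isOpen_iff.1 hopen w hh
  refine ⟨η, hη, fun y hy g => ?_⟩
  have hy' : dist z (h • y) < δ := hball (Metric.mem_ball'.2 hy)
  have h₁ := hzδ _ hh (g * h⁻¹)
  have h₂ := hzδ _ hy' (g * h⁻¹)
  simp only [mul_smul, inv_smul_smul] at h₁ h₂
  linarith [dist_triangle_left (g • w) (g • y) (g • h⁻¹ • z)]

theorem dense_orbit_smul {G X : Type*} [Group G] [MetricSpace X] [MulAction G X] {x : X}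
    (hx : Dense (MulAction.orbit G x)) (g : G) : Dense (MulAction.orbit G (g • x)) := by
  rwa [MulAction.orbit_smul]

/-- For a system with a transitive point `x`, the following are equivalent:
(1) the system is almost equicontinuous; (2) `x` is an equicontinuous point;
(3) for all `ε > 0` there is `δ > 0` such that `d(h • x, x) < δ` implies
`d(gh • x, g • x) < ε` for all `g, h`; (4) `d` and `d_∞` induce the same topology
on the set of transitive points. -/
theorem almostEqcts_tfae
    {G X : Type*} [Group G] [MetricSpace X] [CompactSpace X] [MulAction G X]
    (hcont : ∀ g : G, Continuous fun x : X => g • x)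
    {x : X} (hx : Dense (MulAction.orbit G x)) :
    List.TFAE
      [ Dense {z : X | IsEqctsPt G z},
        IsEqctsPt G x,
        ∀ ε > (0 : ℝ), ∃ δ > (0 : ℝ), ∀ g h : G,
          dist (h • x) x < δ → dist ((g * h) • x) (g • x) < ε,
        (∀ z ∈ {w : X | Dense (MulAction.orbit G w)}, ∀ ε > (0 : ℝ), ∃ δ > (0 : ℝ),
            ∀ w ∈ {w : X | Dense (MulAction.orbit G w)}, dist z w < δ → dInfty G z w < ε) ∧
        (∀ z ∈ {w : X | Dense (MulAction.orbit G w)}, ∀ ε > (0 : ℝ), ∃ δ > (0 : ℝ),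
            ∀ w ∈ {w : X | Dense (MulAction.orbit G w)}, dInfty G z w < δ → dist z w < ε) ] := by
  have eqcts {z w : X} (hz : IsEqctsPt G z) (hw : Dense (MulAction.orbit G w)) :
      IsEqctsPt G w := hz.of_dense_orbit hcont hw
  tfae_have 1 → 2 := fun h => by
    have : Nonempty X := ⟨x⟩
    obtain ⟨z, hz⟩ := h.nonempty
    exact eqcts hz hx
  tfae_have 2 → 1 := fun h => by
    refine hx.mono ?_
    rintro _ ⟨g, rfl⟩
    exact eqcts h (dense_orbit_smul hx g)
  tfae_have 2 → 3 := fun h ε hε => by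
    obtain ⟨δ, hδ, H⟩ := h ε hε
    refine ⟨δ, hδ, fun g k hk => ?_⟩
    rw [mul_smul, dist_comm]
    exact H _ (by rwa [dist_comm]) g
  tfae_have 3 → 2 := fun h ε hε => by
    obtain ⟨δ, hδ, H⟩ := h (ε / 2) (half_pos hε)
    refine ⟨δ, hδ, fun y hy g => ?_⟩
    have hopen : IsOpen {u : X | dist u x < δ ∧ dist (g • u) (g • y) < ε / 2} :=
      (isOpen_lt (continuous_id.dist continuous_const) continuous_const).inter
        (isOpen_lt ((hcont g).dist continuous_const) continuous_const)
    obtain ⟨_, ⟨hux, huy⟩, k, rfl⟩ := hx.inter_open_nonempty _ hopen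
      ⟨y, by rwa [dist_comm], by simpa using hε⟩
    have hgk := H g k hux
    rw [mul_smul] at hgk
    linarith [dist_triangle_left (g • x) (g • y) (g • k • x)]
  tfae_have 2 → 4 := fun h => by
    refine ⟨fun z hz ε hε => ?_, fun z _ ε hε => ⟨ε, hε, fun w _ hzw => ?_⟩⟩
    · obtain ⟨δ, hδ, H⟩ := eqcts h hz (ε / 2) (half_pos hε)
      exact ⟨δ, hδ, fun w _ hzw =>
        (ciSup_le fun g => (H w hzw g).le).trans_lt (half_lt_self hε)⟩
    · simpa using (dist_smul_le_dInfty (1 : G) z w).trans_lt hzw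
  tfae_have 4 → 3 := fun h ε hε => by
    obtain ⟨δ, hδ, H⟩ := h.1 x hx ε hε
    refine ⟨δ, hδ, fun g k hk => ?_⟩
    rw [mul_smul, dist_comm]
    exact (dist_smul_le_dInfty g x (k • x)).trans_lt
      (H _ (dense_orbit_smul hx k) (by rwa [dist_comm]))
  tfae_finish
end

section
/- Let a group G act by isometries on a complete metric space X, let x₀ ∈ X have dense orbit, and define ‖g‖ := d(x₀, g·x₀) for g ∈ G. Then X is compact if and only if for every ε > 0 the set {g ∈ G : ‖g‖ < ε} is left syndetic. -/
/-- `{g : ‖g‖ < ε}` is left syndetic iff finitely many `ε`-balls centred at points of the orbit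
of `x₀` cover the orbit. -/
theorem leftSyndetic_norm_ball_iff {G X : Type*} [Group G] [PseudoMetricSpace X] [MulAction G X]
    (hiso : ∀ g : G, Isometry fun x : X => g • x) (x₀ : X) (ε : ℝ) :
    LeftSyndetic {g : G | dist x₀ (g • x₀) < ε} ↔
      ∃ F : Finset G, MulAction.orbit G x₀ ⊆ ⋃ f ∈ F, Metric.ball (f • x₀) ε := by
  have hdist (f g : G) : dist x₀ ((f⁻¹ * g) • x₀) = dist (g • x₀) (f • x₀) := by
    rw [← (hiso f).dist_eq, smul_smul, mul_inv_cancel_left, dist_comm]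
  refine exists_congr fun F => ⟨?_, fun h g => ?_⟩
  · rintro h _ ⟨g, rfl⟩
    obtain ⟨f, hf, r, hr, rfl⟩ := h g
    refine Set.mem_biUnion hf ?_
    simpa [← hdist] using hr
  · obtain ⟨f, hf, hg⟩ := Set.mem_iUnion₂.1 (h (MulAction.mem_orbit x₀ g))
    exact ⟨f, hf, f⁻¹ * g, (hdist f g).trans_lt hg, (mul_inv_cancel_left f g).symm⟩

/-- Let `G` act by isometries on a complete metric space `X` with a point `x₀` of dense
orbit, and put `‖g‖ = d(x₀, g • x₀)`.  Then `X` is compact iff for every `ε > 0` the set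
`{g : ‖g‖ < ε}` is left syndetic. -/
theorem compact_iff_norm_balls_leftSyndetic
    {G X : Type*} [Group G] [MetricSpace X] [CompleteSpace X] [MulAction G X]
    (hiso : ∀ g : G, Isometry fun x : X => g • x)
    (x₀ : X) (hx₀ : Dense (MulAction.orbit G x₀)) :
    CompactSpace X ↔ ∀ ε > (0 : ℝ), LeftSyndetic {g : G | dist x₀ (g • x₀) < ε} := by
  simp only [leftSyndetic_norm_ball_iff hiso]
  constructor
  · intro _ ε hε
    obtain ⟨F, hF⟩ := isCompact_univ.elim_finite_subcover
      (fun f : G => Metric.ball (f • x₀) ε) (fun _ => Metric.isOpen_ball) fun x _ => by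
        obtain ⟨_, ⟨f, rfl⟩, hf⟩ := hx₀.exists_dist_lt x hε
        exact Set.mem_iUnion.2 ⟨f, hf⟩
    exact ⟨F, (Set.subset_univ _).trans hF⟩
  · intro h
    have htb : TotallyBounded (MulAction.orbit G x₀) := Metric.totallyBounded_iff.2 fun ε hε => by
      obtain ⟨F, hF⟩ := h ε hε
      refine ⟨(fun f : G => f • x₀) '' F, F.finite_toSet.image _, ?_⟩
      simpa only [Set.biUnion_image, SetLike.mem_coe] using hF
    exact ⟨hx₀.closure_eq ▸ htb.closure.isCompact_of_isClosed isClosed_closure⟩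
end

section
/- Let a group G act by isometries on a complete metric space X, let x₀ ∈ X have dense orbit, and define ‖g‖ := d(x₀, g·x₀) for g ∈ G. Then every point of X is recurrent (i.e., for every x ∈ X, every ε > 0, and every finite set K ⊆ G there exists g ∈ G \ K with d(g·x, x) < ε) if and only if there exists a sequence g_n ∈ G that eventually leaves every finite subset of G and satisfies ‖g_n‖ → 0. -/
open Filter Topology in
/-- If for every `ε > 0` a nonnegative function takes values below `ε` outside every finite set,
then it tends to zero along some sequence leaving every finite set. -/
theorem exists_seq_tendsto_cofinite_of_forall_finset {α : Type*} {f : α → ℝ}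
    (hf : ∀ a, 0 ≤ f a) (h : ∀ ε > (0 : ℝ), ∀ K : Finset α, ∃ a, a ∉ K ∧ f a < ε) :
    ∃ u : ℕ → α, Tendsto u atTop cofinite ∧ Tendsto (fun n => f (u n)) atTop (𝓝 0) := by
  classical
  obtain ⟨v, hv, hlt⟩ := exists_seq_of_forall_finset_exists
    (fun p : ℕ × α => f p.2 < 1 / ((p.1 : ℝ) + 1)) (fun p q => p.1 < q.1 ∧ p.2 ≠ q.2) (by
      intro s _
      obtain ⟨a, ha, hfa⟩ := h (1 / (((s.sup Prod.fst + 1 : ℕ) : ℝ) + 1))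
        Nat.one_div_pos_of_nat (s.image Prod.snd)
      refine ⟨(s.sup Prod.fst + 1, a), hfa, fun p hp =>
        ⟨Nat.lt_succ_of_le (Finset.le_sup (f := Prod.fst) hp), ?_⟩⟩
      rintro rfl
      exact ha (Finset.mem_image_of_mem _ hp))
  have hmono : StrictMono fun n => (v n).1 := fun m n hmn => (hlt m n hmn).1
  have hinj : Function.Injective fun n => (v n).2 :=
    .of_lt_imp_ne fun m n hmn => (hlt m n hmn).2
  refine ⟨fun n => (v n).2, ?_, ?_⟩
  · rw [← Nat.cofinite_eq_atTop]
    exact hinj.tendsto_cofinite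
  · exact squeeze_zero (fun n => hf _) (fun n => (hv n).le)
      ((tendsto_one_div_add_atTop_nhds_zero_nat (𝕜 := ℝ)).comp hmono.tendsto_atTop)

/-- Let `G` act by isometries on a complete metric space `X` with a point `x₀` of dense
orbit, and put `‖g‖ = d(x₀, g • x₀)`.  Every point of `X` is recurrent iff there is a
sequence `g_n` leaving every finite subset of `G` with `‖g_n‖ → 0`. -/
theorem recurrent_iff_norm_small_sequence
    {G X : Type*} [Group G] [MetricSpace X] [CompleteSpace X] [MulAction G X]
    (hiso : ∀ g : G, Isometry fun x : X => g • x)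
    (x₀ : X) (hx₀ : Dense (MulAction.orbit G x₀)) :
    (∀ (x : X), ∀ ε > (0 : ℝ), ∀ K : Finset G, ∃ g : G, g ∉ K ∧ dist (g • x) x < ε) ↔
      ∃ g : ℕ → G, Filter.Tendsto g Filter.atTop Filter.cofinite ∧
        Filter.Tendsto (fun n => dist x₀ (g n • x₀)) Filter.atTop (nhds 0) := by
  classical
  constructor
  · intro h
    refine exists_seq_tendsto_cofinite_of_forall_finset
      (f := fun g : G => dist x₀ (g • x₀)) (fun _ => dist_nonneg) fun ε hε K => ?_
    obtain ⟨g, hgK, hg⟩ := h x₀ ε hε K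
    exact ⟨g, hgK, by rwa [dist_comm]⟩
  · rintro ⟨g, hg, hnorm⟩ x ε hε K
    obtain ⟨_, ⟨h, rfl⟩, hx⟩ := hx₀.exists_dist_lt x (by positivity : 0 < ε / 3)
    have hout : ∀ᶠ n in Filter.atTop, g n ∉ K.image fun k => h⁻¹ * k * h :=
      hg.eventually (Finset.eventually_cofinite_notMem _)
    obtain ⟨n, hnK, hn⟩ :=
      (hout.and (hnorm.eventually_lt_const (by positivity : 0 < ε / 3))).exists
    refine ⟨h * g n * h⁻¹, fun hK => hnK (Finset.mem_image.2 ⟨_, hK, by group⟩), ?_⟩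
    have h₁ : dist ((h * g n * h⁻¹) • x) ((h * g n * h⁻¹) • h • x₀) = dist x (h • x₀) :=
      (hiso _).dist_eq _ _
    have h₂ : dist ((h * g n * h⁻¹) • h • x₀) (h • x₀) = dist x₀ (g n • x₀) := by
      rw [smul_smul, inv_mul_cancel_right, mul_smul, (hiso h).dist_eq, dist_comm]
    have h₃ := dist_triangle4 ((h * g n * h⁻¹) • x) ((h * g n * h⁻¹) • h • x₀) (h • x₀) x
    rw [h₁, h₂, dist_comm (h • x₀) x] at h₃
    change dist x (h • x₀) < ε / 3 at hx
    linarith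
end

section
/- Define φ : ℤ → [0,∞) by φ(0) = 0, φ(m) = min{ 1/(n+1) : n ≥ 0, n! = |m| } when |m| is a factorial, and φ(m) = 1 otherwise; define ‖m‖ := inf{ φ(m₁) + ⋯ + φ(m_k) : k ≥ 1, m₁ + ⋯ + m_k = m }. Then: (a) for every integer n ≥ 1, { m ∈ ℤ : ‖m‖ < 1/n, m > 0 } ⊆ ⋃_{k ≥ n} ⋃_{a=1}^{k+1} [ k!(a − 1/n), k!(a + 1/n) ]; (b) ‖m‖ > 0 for every m ≠ 0; (c) for every n ≥ 1 the set { m ∈ ℤ : m ≠ 0 and ‖m‖ < 1/n } is not syndetic in ℤ. -/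
/-- The norm on `ℤ` induced by a weight function `φ`:
`‖m‖ = inf { φ(m₁) + ⋯ + φ(m_k) : k ≥ 1, m₁ + ⋯ + m_k = m }`. -/
noncomputable def intNorm (φ : ℤ → ℝ) (m : ℤ) : ℝ :=
  sInf {r : ℝ | ∃ l : List ℤ, l ≠ [] ∧ l.sum = m ∧ r = (l.map φ).sum}

/-- The properties of the factorial weight that its norm estimates depend on. -/
structure IsFactorialWeight (φ : ℤ → ℝ) : Prop where
  zero : φ 0 = 0
  nonneg : ∀ x, 0 ≤ φ x
  eq_of_lt_one : ∀ x, φ x < 1 →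
    x = 0 ∨ ∃ k : ℕ, |x| = (Nat.factorial k : ℤ) ∧ φ x = 1 / ((k : ℝ) + 1)

/-- The sum of the entries of `l` of absolute value less than `K!`. -/
def smallSum (K : ℕ) (l : List ℤ) : ℤ :=
  (l.map fun x => if |x| < (Nat.factorial K : ℤ) then x else 0).sum

/-- The total weight of the entries of `l` of absolute value less than `K!`. -/
noncomputable def smallCost (φ : ℤ → ℝ) (K : ℕ) (l : List ℤ) : ℝ :=
  (l.map fun x => if |x| < (Nat.factorial K : ℤ) then φ x else 0).sum

theorem exists_list_of_intNorm_lt {φ : ℤ → ℝ} {m : ℤ} {c : ℝ} (h : intNorm φ m < c) :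
    ∃ l : List ℤ, l.sum = m ∧ (l.map φ).sum < c := by
  obtain ⟨r, ⟨l, -, hl, rfl⟩, hr⟩ :=
    exists_lt_of_csInf_lt (by exact ⟨_, [m], by simp, by simp, rfl⟩) h
  exact ⟨l, hl, hr⟩

theorem smallSum_zero (l : List ℤ) : smallSum 0 l = 0 := by
  induction l with
  | nil => simp [smallSum]
  | cons x l ih =>
    simp only [smallSum, List.map_cons, List.sum_cons] at ih ⊢
    rw [ih]
    simp

theorem smallSum_eq_sum {K : ℕ} {l : List ℤ}
    (h : ∀ x ∈ l, |x| < (Nat.factorial K : ℤ)) : smallSum K l = l.sum := by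
  induction l with
  | nil => simp [smallSum]
  | cons x l ih =>
    have h1 := h x (by simp)
    have h2 := ih fun y hy => h y (by simp [hy])
    simp only [smallSum, List.map_cons, List.sum_cons, if_pos h1] at h2 ⊢
    rw [h2]

theorem exists_abs_lt_factorial (l : List ℤ) :
    ∃ K : ℕ, ∀ x ∈ l, |x| < (Nat.factorial K : ℤ) := by
  induction l with
  | nil => exact ⟨0, by simp⟩
  | cons x l ih =>
    obtain ⟨K, hK⟩ := ih
    refine ⟨max K (x.natAbs + 1), fun y hy => ?_⟩
    rcases List.mem_cons.1 hy with rfl | hy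
    · rw [Int.abs_eq_natAbs]
      have h1 := Nat.self_le_factorial (max K (y.natAbs + 1))
      have h2 := le_max_right K (y.natAbs + 1)
      omega
    · exact (hK y hy).trans_le (by exact_mod_cast Nat.factorial_le (le_max_left _ _))

namespace IsFactorialWeight

variable {φ : ℤ → ℝ}

theorem le_sum (hφ : IsFactorialWeight φ) {l : List ℤ} {x : ℤ} (hx : x ∈ l) :
    φ x ≤ (l.map φ).sum :=
  List.single_le_sum (by simpa using fun y _ => hφ.nonneg y) _ (List.mem_map_of_mem hx)

theorem lt_one_of_mem (hφ : IsFactorialWeight φ) {l : List ℤ} (h : (l.map φ).sum < 1) :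
    ∀ x ∈ l, φ x < 1 :=
  fun _ hx => (hφ.le_sum hx).trans_lt h

theorem abs_le_factorial_mul (hφ : IsFactorialWeight φ) {x : ℤ} (h : φ x < 1) {K : ℕ}
    (hK : |x| < (Nat.factorial K : ℤ)) : |(x : ℝ)| ≤ Nat.factorial K * φ x := by
  rcases hφ.eq_of_lt_one x h with rfl | ⟨k, hk, hkφ⟩
  · simp [hφ.zero]
  · have hkK : k < K := by
      by_contra! hle
      have := Nat.factorial_le hle
      omega
    have h1 : ((k : ℝ) + 1) * Nat.factorial k ≤ Nat.factorial K := by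
      exact_mod_cast Nat.factorial_le (Nat.succ_le_of_lt hkK)
    have h2 : |(x : ℝ)| = Nat.factorial k := by exact_mod_cast hk
    rw [h2, hkφ, mul_one_div, le_div_iff₀ (by positivity)]
    linarith

theorem dvd (hφ : IsFactorialWeight φ) {x : ℤ} (h : φ x < 1) {K : ℕ}
    (hK : ¬ |x| < (Nat.factorial K : ℤ)) : (Nat.factorial K : ℤ) ∣ x := by
  rcases hφ.eq_of_lt_one x h with rfl | ⟨k, hk, -⟩
  · simp
  · rw [← dvd_abs, hk]
    rcases le_total K k with hle | hle
    · exact_mod_cast Nat.factorial_dvd_factorial hle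
    · have := Nat.factorial_le hle
      have : Nat.factorial k = Nat.factorial K := by omega
      rw [this]

theorem eq_zero (hφ : IsFactorialWeight φ) {n : ℕ} (hn : 1 ≤ n) {x : ℤ}
    (h : φ x < 1 / (n : ℝ)) (hx : |x| < (Nat.factorial n : ℤ)) : x = 0 := by
  have hn' : (1 : ℝ) ≤ n := by exact_mod_cast hn
  have h1 : 1 / (n : ℝ) ≤ 1 := by rw [div_le_one (by positivity)]; exact hn'
  rcases hφ.eq_of_lt_one x (h.trans_le h1) with hx0 | ⟨k, hk, hkφ⟩
  · exact hx0
  · rw [hkφ, one_div_lt_one_div (by positivity) (by positivity)] at h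
    have hnk : n ≤ k := by
      have : n < k + 1 := by exact_mod_cast h
      omega
    have := Nat.factorial_le hnk
    omega

theorem dvd_sum_sub_smallSum (hφ : IsFactorialWeight φ) (K : ℕ) {l : List ℤ}
    (h : ∀ x ∈ l, φ x < 1) : (Nat.factorial K : ℤ) ∣ l.sum - smallSum K l := by
  induction l with
  | nil => simp [smallSum]
  | cons x l ih =>
    have h1 := ih fun y hy => h y (by simp [hy])
    simp only [smallSum, List.map_cons, List.sum_cons] at h1 ⊢
    rw [add_sub_add_comm]
    refine dvd_add ?_ h1
    split_ifs with hx
    · simp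
    · simpa using hφ.dvd (h x (by simp)) hx

theorem abs_smallSum_sub_le (hφ : IsFactorialWeight φ) {j K : ℕ} (hjK : j ≤ K) {l : List ℤ}
    (h : ∀ x ∈ l, φ x < 1) :
    |(smallSum K l : ℝ) - smallSum j l| ≤
      Nat.factorial K * (smallCost φ K l - smallCost φ j l) := by
  induction l with
  | nil => simp [smallSum, smallCost]
  | cons x l ih =>
    have h1 := ih fun y hy => h y (by simp [hy])
    have hx := h x (by simp)
    simp only [smallSum, smallCost, List.map_cons, List.sum_cons, Int.cast_add] at h1 ⊢
    rw [add_sub_add_comm, add_sub_add_comm, mul_add]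
    refine (abs_add_le _ _).trans (add_le_add ?_ h1)
    have hf : (Nat.factorial j : ℤ) ≤ Nat.factorial K := by
      exact_mod_cast Nat.factorial_le hjK
    by_cases hj : |x| < (Nat.factorial j : ℤ)
    · simp [hj, hj.trans_le hf]
    · by_cases hK : |x| < (Nat.factorial K : ℤ)
      · simpa [hj, hK] using hφ.abs_le_factorial_mul hx hK
      · simp [hj, hK]

theorem smallCost_nonneg (hφ : IsFactorialWeight φ) (K : ℕ) (l : List ℤ) :
    0 ≤ smallCost φ K l := by
  refine List.sum_nonneg fun r hr => ?_
  obtain ⟨x, -, rfl⟩ := List.mem_map.1 hr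
  split_ifs
  exacts [hφ.nonneg x, le_rfl]

theorem smallCost_le (hφ : IsFactorialWeight φ) (K : ℕ) (l : List ℤ) :
    smallCost φ K l ≤ (l.map φ).sum := by
  refine List.sum_le_sum fun x _ => ?_
  split_ifs
  exacts [le_rfl, hφ.nonneg x]

theorem abs_smallSum_le (hφ : IsFactorialWeight φ) (K : ℕ) {l : List ℤ}
    (h : ∀ x ∈ l, φ x < 1) : |(smallSum K l : ℝ)| ≤ Nat.factorial K * smallCost φ K l := by
  have h1 := hφ.abs_smallSum_sub_le (Nat.zero_le K) h
  rw [smallSum_zero, Int.cast_zero, sub_zero] at h1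
  refine h1.trans (mul_le_mul_of_nonneg_left ?_ (by positivity))
  linarith [hφ.smallCost_nonneg 0 l]

/-- An integer of norm less than `1 / n` is close to a nonzero multiple of a factorial. -/
theorem exists_abs_sub_lt (hφ : IsFactorialWeight φ) {n : ℕ} (hn : 1 ≤ n) {m : ℤ} (hm : m ≠ 0)
    (h : intNorm φ m < 1 / (n : ℝ)) :
    ∃ k : ℕ, n ≤ k ∧ ∃ a : ℤ, a ≠ 0 ∧ |a| ≤ k + 1 ∧
      |(m : ℝ) - Nat.factorial k * a| < Nat.factorial k * (1 / (n : ℝ)) := by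
  obtain ⟨l, hl, hc⟩ := exists_list_of_intNorm_lt h
  have hn' : (1 : ℝ) ≤ n := by exact_mod_cast hn
  have hn1 : 1 / (n : ℝ) ≤ 1 := by rw [div_le_one (by positivity)]; exact hn'
  have hl1 := hφ.lt_one_of_mem (hc.trans_le hn1)
  have hex : ∃ K, smallSum K l = m := by
    obtain ⟨K, hK⟩ := exists_abs_lt_factorial l
    exact ⟨K, (smallSum_eq_sum hK).trans hl⟩
  have hzero : ∀ K ≤ n, smallSum K l = 0 := by
    intro K hK
    refine List.sum_eq_zero fun r hr => ?_
    obtain ⟨x, hx, rfl⟩ := List.mem_map.1 hr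
    split_ifs with hxK
    · exact hφ.eq_zero hn ((hφ.le_sum hx).trans_lt hc)
        (hxK.trans_le (by exact_mod_cast Nat.factorial_le hK))
    · rfl
  classical
  obtain ⟨k, hk⟩ : ∃ k, Nat.find hex = k + 1 := by
    refine Nat.exists_eq_succ_of_ne_zero fun h0 => hm ?_
    rw [← Nat.find_spec hex, h0, hzero 0 (Nat.zero_le _)]
  have hk1 : smallSum (k + 1) l = m := hk ▸ Nat.find_spec hex
  have hk0 : smallSum k l ≠ m := Nat.find_min hex (by omega)
  have hnk : n ≤ k := by
    by_contra! hlt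
    exact hm (hk1 ▸ hzero (k + 1) hlt)
  obtain ⟨a, ha⟩ := hφ.dvd_sum_sub_smallSum k hl1
  rw [hl] at ha
  have haR : (m : ℝ) - smallSum k l = Nat.factorial k * a := by exact_mod_cast ha
  have hpos : (0 : ℝ) < Nat.factorial k := by exact_mod_cast Nat.factorial_pos k
  refine ⟨k, hnk, a, ?_, ?_, ?_⟩
  · rintro rfl
    exact hk0 (by linarith)
  · have h1 := hφ.abs_smallSum_sub_le (Nat.le_succ k) hl1
    rw [Nat.succ_eq_add_one, hk1, haR, abs_mul, abs_of_pos hpos, Nat.factorial_succ] at h1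
    have h2 : smallCost φ (k + 1) l - smallCost φ k l ≤ 1 := by
      linarith [hφ.smallCost_nonneg k l, hφ.smallCost_le (k + 1) l]
    have h3 : |(a : ℝ)| ≤ k + 1 := by
      refine le_of_mul_le_mul_left (h1.trans ?_) hpos
      push_cast
      nlinarith [mul_le_mul_of_nonneg_left h2 (by positivity : (0 : ℝ) ≤ (k + 1) * Nat.factorial k)]
    exact_mod_cast h3
  · rw [← haR, sub_sub_cancel]
    refine (hφ.abs_smallSum_le k hl1).trans_lt (mul_lt_mul_of_pos_left ?_ hpos)
    exact (hφ.smallCost_le k l).trans_lt hc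

theorem intNorm_pos (hφ : IsFactorialWeight φ) {m : ℤ} (hm : m ≠ 0) : 0 < intNorm φ m := by
  by_contra! h
  obtain ⟨k, hk, a, ha, -, hlt⟩ := hφ.exists_abs_sub_lt (n := m.natAbs + 2) (by omega) hm
    (h.trans_lt (by positivity))
  have h1 : (1 : ℝ) ≤ |(a : ℝ)| := by exact_mod_cast Int.one_le_abs ha
  have h2 : ((m.natAbs + 2 : ℕ) : ℝ) ≤ Nat.factorial k := by
    exact_mod_cast hk.trans (Nat.self_le_factorial k)
  have h3 : |(m : ℝ)| = m.natAbs := by rw [Nat.cast_natAbs, Int.cast_abs]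
  have h4 := abs_sub_abs_le_abs_sub ((Nat.factorial k : ℝ) * a) m
  rw [abs_mul, Nat.abs_cast, abs_sub_comm, h3] at h4
  have h5 := mul_le_mul_of_nonneg_left h1 (Nat.cast_nonneg (α := ℝ) (Nat.factorial k))
  set N : ℝ := ((m.natAbs + 2 : ℕ) : ℝ) with hN
  have hN2 : N = m.natAbs + 2 := by rw [hN]; push_cast; ring
  have hNpos : 0 < N := by rw [hN2]; positivity
  have h6 : N * (1 - 1 / N) = N - 1 := by field_simp
  have h7 : 0 ≤ 1 - 1 / N := by
    rw [sub_nonneg, div_le_one hNpos, hN2]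
    linarith [Nat.cast_nonneg (α := ℝ) m.natAbs]
  nlinarith [mul_le_mul_of_nonneg_right h2 h7]

end IsFactorialWeight

/-- If `y` is within `e / 2` of an odd multiple of `D / 2`, then every integer congruent to `y`
modulo `D` has absolute value at least `(D - e) / 2`. -/
theorem sub_le_two_mul_abs_of_dvd {D y P w : ℤ} {e : ℝ} (hD : 0 ≤ D) (h : D ∣ y - P)
    (he : |2 * (y : ℝ) - D * (2 * w + 1)| ≤ e) : D - e ≤ 2 * |(P : ℝ)| := by
  obtain ⟨t, ht⟩ := h
  have hy : (y : ℝ) = P + D * t := by exact_mod_cast (by linarith : y = P + D * t)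
  have h1 : (1 : ℝ) ≤ |2 * ((t : ℝ) - w) - 1| := by
    exact_mod_cast Int.one_le_abs (by omega : 2 * (t - w) - 1 ≠ 0)
  have hD' : (0 : ℝ) ≤ D := by exact_mod_cast hD
  have h2 := mul_le_mul_of_nonneg_left h1 hD'
  have h3 : (D : ℝ) * |2 * ((t : ℝ) - w) - 1| = |(2 * (y : ℝ) - D * (2 * w + 1)) - 2 * P| := by
    rw [← abs_of_nonneg hD', ← abs_mul, abs_of_nonneg hD', hy]
    congr 1
    ring
  have h4 := abs_sub (2 * (y : ℝ) - D * (2 * w + 1)) (2 * P)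
  rw [abs_mul, abs_two] at h4
  linarith

theorem exists_factorial_add_eq (a : ℕ) :
    ∃ u : ℕ, 1 ≤ u ∧ Nat.factorial (a + 18) = Nat.factorial a * (18 * u) := by
  have h : Nat.factorial a * 18 ∣ Nat.factorial (a + 18) :=
    (Nat.mul_dvd_mul_left _ (Nat.dvd_factorial (by norm_num) le_rfl)).trans
      (Nat.factorial_mul_factorial_dvd_factorial_add a 18)
  obtain ⟨u, hu⟩ := h
  refine ⟨u, Nat.one_le_iff_ne_zero.2 ?_, by rw [hu, mul_assoc]⟩
  rintro rfl
  exact (Nat.factorial_pos (a + 18)).ne' (by simpa using hu)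

/-- The half-sum of three well-separated factorials is far from all integers of norm less
than `1`. -/
theorem IsFactorialWeight.one_le_intNorm {φ : ℤ → ℝ} (hφ : IsFactorialWeight φ) {a : ℕ} {y : ℤ}
    (h : 3 * |2 * y - (Nat.factorial a + Nat.factorial (a + 18) + Nat.factorial (a + 18 + 18))|
      ≤ (Nat.factorial a : ℤ)) : 1 ≤ intNorm φ y := by
  by_contra! hlt
  obtain ⟨l, hl, hc⟩ := exists_list_of_intNorm_lt hlt
  have hl1 := hφ.lt_one_of_mem hc
  obtain ⟨u, hu1, hu⟩ := exists_factorial_add_eq a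
  obtain ⟨v, hv1, hv⟩ := exists_factorial_add_eq (a + 18)
  have da := hφ.dvd_sum_sub_smallSum a hl1
  have db := hφ.dvd_sum_sub_smallSum (a + 18) hl1
  have dc := hφ.dvd_sum_sub_smallSum (a + 18 + 18) hl1
  have ca := hφ.abs_smallSum_le a hl1
  have cb := hφ.abs_smallSum_le (a + 18) hl1
  have cab := hφ.abs_smallSum_sub_le (Nat.le_add_right a 18) hl1
  have cbc := hφ.abs_smallSum_sub_le (Nat.le_add_right (a + 18) 18) hl1
  have sa := hφ.smallCost_le a l
  have sb := hφ.smallCost_le (a + 18) l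
  have sc := hφ.smallCost_le (a + 18 + 18) l
  have hA0 := Nat.factorial_pos a
  rw [hl] at da db dc
  generalize Nat.factorial (a + 18 + 18) = C at *
  generalize Nat.factorial (a + 18) = B at *
  generalize Nat.factorial a = A at *
  have hR : 3 * |2 * (y : ℝ) - (A + B + C)| ≤ A := by exact_mod_cast h
  have hA : (0 : ℝ) < A := by exact_mod_cast hA0
  have huR : (B : ℝ) = A * (18 * u) := by exact_mod_cast hu
  have hvR : (C : ℝ) = B * (18 * v) := by exact_mod_cast hv
  have hAB : 18 * (A : ℝ) ≤ B := by
    have : (1 : ℝ) ≤ u := by exact_mod_cast hu1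
    nlinarith
  have hBC : 18 * (B : ℝ) ≤ C := by
    have : (1 : ℝ) ≤ v := by exact_mod_cast hv1
    nlinarith
  obtain ⟨hR1, hR2⟩ := abs_le.1 (by linarith : |2 * (y : ℝ) - (A + B + C)| ≤ A / 3)
  have ea := sub_le_two_mul_abs_of_dvd (w := 9 * u + 162 * u * v) (e := A / 3)
    (Int.natCast_nonneg A) da (by
      rw [abs_le]; push_cast
      have : (A : ℝ) * (2 * (9 * u + 162 * u * v) + 1) = A + B + C := by rw [hvR, huR]; ring
      constructor <;> linarith)
  have eb := sub_le_two_mul_abs_of_dvd (w := 9 * v) (e := A + A / 3)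
    (Int.natCast_nonneg B) db (by
      rw [abs_le]; push_cast
      have : (B : ℝ) * (2 * (9 * v) + 1) = B + C := by rw [hvR]; ring
      constructor <;> linarith)
  have ec := sub_le_two_mul_abs_of_dvd (w := 0) (e := B + A + A / 3)
    (Int.natCast_nonneg C) dc (by
      rw [abs_le]; push_cast
      constructor <;> linarith)
  push_cast at ea eb ec
  have tb := abs_sub_abs_le_abs_sub (smallSum (a + 18) l : ℝ) (smallSum a l)
  have tc := abs_sub_abs_le_abs_sub (smallSum (a + 18 + 18) l : ℝ) (smallSum (a + 18) l)
  have hB : (0 : ℝ) < B := by linarith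
  have hC : (0 : ℝ) < C := by linarith
  have pa : (A : ℝ) * smallCost φ a l ≤ A := by nlinarith
  have pb : (B : ℝ) * smallCost φ (a + 18) l ≤ B := by nlinarith
  have ra : 1 / 3 ≤ smallCost φ a l := le_of_mul_le_mul_left (by linarith) hA
  have rb : 1 / 3 ≤ smallCost φ (a + 18) l - smallCost φ a l :=
    le_of_mul_le_mul_left (by linarith) hB
  have rc : 1 / 3 ≤ smallCost φ (a + 18 + 18) l - smallCost φ (a + 18) l :=
    le_of_mul_le_mul_left (by linarith) hC
  linarith

theorem isFactorialWeight_of_isLeast {φ : ℤ → ℝ} (hφ0 : φ 0 = 0)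
    (hφfact : ∀ m : ℤ, m ≠ 0 → {n : ℕ | (Nat.factorial n : ℤ) = |m|}.Nonempty →
      IsLeast ((fun n : ℕ => (1 : ℝ) / (n + 1)) '' {n : ℕ | (Nat.factorial n : ℤ) = |m|}) (φ m))
    (hφother : ∀ m : ℤ, m ≠ 0 → (∀ n : ℕ, (Nat.factorial n : ℤ) ≠ |m|) → φ m = 1) :
    IsFactorialWeight φ := by
  have key : ∀ x, x = 0 ∨ φ x = 1 ∨
      ∃ k : ℕ, |x| = (Nat.factorial k : ℤ) ∧ φ x = 1 / ((k : ℝ) + 1) := by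
    intro x
    by_cases hx : x = 0
    · exact .inl hx
    by_cases h : {n : ℕ | (Nat.factorial n : ℤ) = |x|}.Nonempty
    · obtain ⟨k, hk, hkx⟩ := (hφfact x hx h).1
      exact .inr (.inr ⟨k, hk.symm, hkx.symm⟩)
    · exact .inr (.inl (hφother x hx fun n hn => h ⟨n, hn⟩))
  refine ⟨hφ0, fun x => ?_, fun x hx => ?_⟩
  · rcases key x with rfl | h | ⟨k, -, h⟩
    · exact hφ0.ge
    · rw [h]; exact zero_le_one
    · rw [h]; positivity
  · rcases key x with h | h | h
    · exact .inl h
    · exact absurd h hx.ne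
    · exact .inr h

/-- For the weight `φ` on `ℤ` with `φ(0) = 0`, `φ(m) = min {1/(n+1) : n! = |m|}` when
`|m|` is a factorial, and `φ(m) = 1` otherwise:
(a) if `‖m‖ < 1/n` and `m > 0` then `m ∈ [k!(a - 1/n), k!(a + 1/n)]` for some `k ≥ n`
and `1 ≤ a ≤ k + 1`; (b) `‖m‖ > 0` for `m ≠ 0`; (c) for each `n ≥ 1` the set
`{m ≠ 0 : ‖m‖ < 1/n}` is not syndetic in `ℤ`. -/
theorem factorial_weight_norm_properties (φ : ℤ → ℝ)
    (hφ0 : φ 0 = 0)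
    (hφfact : ∀ m : ℤ, m ≠ 0 → {n : ℕ | (Nat.factorial n : ℤ) = |m|}.Nonempty →
      IsLeast ((fun n : ℕ => (1 : ℝ) / (n + 1)) '' {n : ℕ | (Nat.factorial n : ℤ) = |m|}) (φ m))
    (hφother : ∀ m : ℤ, m ≠ 0 → (∀ n : ℕ, (Nat.factorial n : ℤ) ≠ |m|) → φ m = 1) :
    (∀ n : ℕ, 1 ≤ n → ∀ m : ℤ, 0 < m → intNorm φ m < 1 / (n : ℝ) →
      ∃ k : ℕ, n ≤ k ∧ ∃ a : ℕ, 1 ≤ a ∧ a ≤ k + 1 ∧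
        (Nat.factorial k : ℝ) * ((a : ℝ) - 1 / (n : ℝ)) ≤ (m : ℝ) ∧
        (m : ℝ) ≤ (Nat.factorial k : ℝ) * ((a : ℝ) + 1 / (n : ℝ))) ∧
    (∀ m : ℤ, m ≠ 0 → 0 < intNorm φ m) ∧
    (∀ n : ℕ, 1 ≤ n → ¬ ∃ F : Finset ℤ, ∀ x : ℤ, ∃ f ∈ F, ∃ r : ℤ,
        (r ≠ 0 ∧ intNorm φ r < 1 / (n : ℝ)) ∧ x = f + r) := by
  have hφ := isFactorialWeight_of_isLeast hφ0 hφfact hφother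
  refine ⟨fun n hn m hm h => ?_, fun m hm => hφ.intNorm_pos hm, ?_⟩
  · obtain ⟨k, hk, a, ha0, hak, hlt⟩ := hφ.exists_abs_sub_lt hn hm.ne' h
    obtain ⟨h1, h2⟩ := abs_lt.1 hlt
    have hpos : (0 : ℝ) < Nat.factorial k := by exact_mod_cast Nat.factorial_pos k
    have hn' : 1 / (n : ℝ) ≤ 1 := by
      have : (1 : ℝ) ≤ n := by exact_mod_cast hn
      rw [div_le_one (by positivity)]
      exact this
    have ha : 0 < a := by
      by_contra! hle
      have ha1 : (a : ℝ) ≤ -1 := by exact_mod_cast (by omega : a ≤ -1)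
      have hm' : (0 : ℝ) < m := by exact_mod_cast hm
      nlinarith
    lift a to ℕ using ha.le
    rw [Nat.abs_cast] at hak
    rw [Int.cast_natCast] at h1 h2
    exact ⟨k, hk, a, by omega, by omega, by linarith, by linarith⟩
  · rintro n hn ⟨F, hF⟩
    set L : ℕ := ∑ f ∈ F, f.natAbs with hL
    set a : ℕ := 6 * L + 2 with ha
    have he : ∀ b, 2 ≤ b → 2 ∣ Nat.factorial b := fun b hb => Nat.dvd_factorial (by norm_num) hb
    have h1 := he a (by omega)
    have h2 := he (a + 18) (by omega)
    have h3 := he (a + 18 + 18) (by omega)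
    obtain ⟨x, hx⟩ := (h1.add h2).add h3
    obtain ⟨f, hf, r, ⟨-, hr⟩, hxr⟩ := hF x
    have hfL : f.natAbs ≤ L :=
      Finset.single_le_sum (f := fun f : ℤ => f.natAbs) (fun _ _ => Nat.zero_le _) hf
    have hLa : a ≤ Nat.factorial a := Nat.self_le_factorial a
    refine absurd (hφ.one_le_intNorm (a := a) (y := r) ?_) (not_le.2 (hr.trans_le ?_))
    · have hx' : (Nat.factorial a : ℤ) + Nat.factorial (a + 18) + Nat.factorial (a + 18 + 18)
          = 2 * x := by exact_mod_cast hx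
      rw [hx', Int.abs_eq_natAbs]
      omega
    · have : (1 : ℝ) ≤ n := by exact_mod_cast hn
      rw [div_le_one (by positivity)]
      exact this
end

section
/- Let G be a countable group acting by measurable bijections on a measurable space X, let μ be a G-invariant ergodic probability measure on X, and let A ⊆ X be measurable with μ(A) > 0. For x ∈ X write R(x,A) = { g ∈ G : g·x ∈ A }. Then for μ-almost every x ∈ X, the set R(x,A)·R(x,A)⁻¹ = { gh⁻¹ : g, h ∈ R(x,A) } is a Δ* set in G. -/
open MeasureTheory Set

/-- Infinitely many measurable sets whose measures are bounded below by a positive constant in a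
finite measure space cannot be pairwise almost disjoint. -/
theorem exists_ne_measure_inter_ne_zero {ι X : Type*} [Infinite ι] [Countable ι]
    [MeasurableSpace X] (μ : Measure X) [IsFiniteMeasure μ] {E : ι → Set X}
    (hE : ∀ i, MeasurableSet (E i)) {c : ENNReal} (hc : c ≠ 0) (hcE : ∀ i, c ≤ μ (E i)) :
    ∃ i j, i ≠ j ∧ μ (E i ∩ E j) ≠ 0 := by
  by_contra! h
  have hunion : μ (⋃ i, E i) = ∑' i, μ (E i) :=
    measure_iUnion₀ (fun i j hij => h i j hij) fun i => (hE i).nullMeasurableSet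
  have htop : ∑' i, μ (E i) = ⊤ :=
    top_le_iff.mp ((ENNReal.tsum_const_eq_top_of_ne_zero hc).symm.le.trans
      (ENNReal.tsum_le_tsum hcE))
  exact measure_ne_top μ _ (hunion.trans htop)

/-- For an ergodic action, almost every orbit meets a given set of positive measure. -/
theorem ae_exists_smul_mem {G X : Type*} [Group G] [Countable G] [MeasurableSpace X]
    [MulAction G X] (hmeas : ∀ g : G, Measurable fun x : X => g • x)
    (μ : Measure X) [IsProbabilityMeasure μ]
    (herg : ∀ s : Set X, MeasurableSet s →
      (∀ g : G, (fun x : X => g • x) ⁻¹' s = s) → μ s = 0 ∨ μ s = 1)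
    {E : Set X} (hE : MeasurableSet E) (hE0 : μ E ≠ 0) :
    ∀ᵐ x ∂μ, ∃ g : G, g • x ∈ E := by
  have hsat : MeasurableSet {x : X | ∃ g : G, g • x ∈ E} := by
    rw [ofPred_exists]
    exact MeasurableSet.iUnion fun g => hmeas g hE
  refine (prob_compl_eq_zero_iff hsat).mpr ((herg _ hsat fun g => ?_).resolve_left fun h0 => ?_)
  · ext x
    constructor
    · rintro ⟨h, hh⟩
      exact ⟨h * g, by rwa [mul_smul]⟩
    · rintro ⟨h, hh⟩
      exact ⟨h * g⁻¹, by rwa [← mul_smul, inv_mul_cancel_right]⟩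
  · exact hE0 (measure_mono_null (fun x (hx : x ∈ E) => show ∃ g : G, g • x ∈ E from
      ⟨1, by rwa [one_smul]⟩) h0)

/-- For a measure-preserving action, the `d` such that `A` meets its translate by `d⁻¹` in a set
of positive measure form a Δ* set. -/
theorem isDeltaStar_measure_inter_ne_zero {G X : Type*} [Group G] [Countable G]
    [MeasurableSpace X] [MulAction G X] (μ : Measure X) [IsFiniteMeasure μ]
    (hinv : ∀ g : G, MeasurePreserving (fun x : X => g • x) μ μ)
    {A : Set X} (hA : MeasurableSet A) (hA0 : μ A ≠ 0) :
    IsDeltaStar {d : G | μ (A ∩ (fun x : X => d • x) ⁻¹' A) ≠ 0} := by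
  rintro B ⟨S, hS, hSB⟩
  have := hS.to_subtype
  obtain ⟨s, t, hst, hpos⟩ := exists_ne_measure_inter_ne_zero μ
    (fun s : S => (hinv s).measurable hA) hA0
    (fun s => ((hinv s).measure_preimage hA.nullMeasurableSet).ge)
  refine ⟨s * (t : G)⁻¹, ?_, hSB ⟨s, s.2, t, t.2, fun h => hst (Subtype.ext h), rfl⟩⟩
  have hmeasA : MeasurableSet (A ∩ (fun x : X => (s * (t : G)⁻¹) • x) ⁻¹' A) :=
    hA.inter ((hinv _).measurable hA)
  rw [mem_ofPred_eq, ← (hinv t).measure_preimage hmeasA.nullMeasurableSet]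
  convert hpos using 2
  ext x
  simp [← mul_smul, and_comm]

/-- For a countable group acting measurably and ergodically on a probability space, and a
set `A` of positive measure, for a.e. `x` the set `R(x,A) R(x,A)⁻¹` is Δ*, where
`R(x,A) = {g : g • x ∈ A}`. -/
theorem returnTimes_diff_deltaStar
    {G X : Type*} [Group G] [Countable G] [MeasurableSpace X] [MulAction G X]
    (hmeas : ∀ g : G, Measurable fun x : X => g • x)
    (μ : MeasureTheory.Measure X) [MeasureTheory.IsProbabilityMeasure μ]
    (hinv : ∀ g : G, MeasureTheory.MeasurePreserving (fun x : X => g • x) μ μ)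
    (herg : ∀ s : Set X, MeasurableSet s →
      (∀ g : G, (fun x : X => g • x) ⁻¹' s = s) → μ s = 0 ∨ μ s = 1)
    (A : Set X) (hA : MeasurableSet A) (hApos : 0 < μ A) :
    ∀ᵐ x ∂μ, IsDeltaStar
      {d : G | ∃ g ∈ {g : G | g • x ∈ A}, ∃ h ∈ {g : G | g • x ∈ A}, d = g * h⁻¹} := by
  have hae : ∀ᵐ x ∂μ, ∀ d : G, μ (A ∩ (fun x : X => d • x) ⁻¹' A) ≠ 0 →
      ∃ g : G, g • x ∈ A ∩ (fun x : X => d • x) ⁻¹' A := by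
    rw [ae_all_iff]
    intro d
    by_cases hd : μ (A ∩ (fun x : X => d • x) ⁻¹' A) = 0
    · exact .of_forall fun x h => absurd hd h
    · filter_upwards [ae_exists_smul_mem hmeas μ herg (hA.inter (hmeas d hA)) hd] with x hx _
      exact hx
  filter_upwards [hae] with x hx B hB
  obtain ⟨d, hd, hdB⟩ := isDeltaStar_measure_inter_ne_zero μ hinv hA hApos.ne' B hB
  obtain ⟨g, hgA, hdgA⟩ := hx d hd
  refine ⟨d, ⟨d * g, ?_, g, hgA, (mul_inv_cancel_right d g).symm⟩, hdB⟩
  simpa [mul_smul] using hdgA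
end

section
/- Let (X,G) be a transitive topological dynamical system with G a countable group. If X admits a G-invariant Borel probability measure of full support, then either (X,G) is minimal and equicontinuous, or (X,G) has sensitive dependence on initial conditions. -/
/-- The system `(X,G)` is equicontinuous. -/
def IsEqctsSys (G : Type*) [Group G] (X : Type*) [MetricSpace X] [MulAction G X] : Prop :=
  ∀ ε > (0 : ℝ), ∃ δ > (0 : ℝ), ∀ x y : X, dist x y < δ → ∀ g : G, dist (g • x) (g • y) < ε

/-- In a non-sensitive compact system, every point with dense orbit has neighbourhoods all of whose
translates are uniformly small. -/
theorem exists_isOpen_forall_dist_smul_le_of_not_isSensitive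
    {G X : Type*} [Group G] [MetricSpace X] [CompactSpace X] [MulAction G X]
    (hcont : ∀ g : G, Continuous fun x : X => g • x) (hns : ¬ IsSensitive G X)
    {x : X} (hx : Dense (MulAction.orbit G x)) {ε : ℝ} (hε : 0 < ε) :
    ∃ V : Set X, IsOpen V ∧ x ∈ V ∧ ∀ g : G, ∀ y ∈ V, ∀ z ∈ V, dist (g • y) (g • z) ≤ ε := by
  unfold IsSensitive at hns
  push Not at hns
  obtain ⟨U, hUo, hUne, hU⟩ := hns ε hε
  obtain ⟨_, hgU, g, rfl⟩ := hx.inter_open_nonempty U hUo hUne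
  refine ⟨(fun z => g • z) ⁻¹' U, hUo.preimage (hcont g), hgU, fun h y hy z hz => ?_⟩
  refine le_trans ?_ (hU (h * g⁻¹))
  refine Metric.dist_le_diam_of_mem (Metric.isBounded_of_compactSpace)
    ⟨g • y, hy, ?_⟩ ⟨g • z, hz, ?_⟩ <;> simp [mul_smul]

/-- For a measure-preserving action on a finite measure space, finitely many translates of a set of
positive measure suffice to meet all its translates. -/
theorem exists_finset_forall_exists_smul_mem
    {G X : Type*} [Group G] [MeasurableSpace X] [MulAction G X]
    (μ : MeasureTheory.Measure X) [MeasureTheory.IsFiniteMeasure μ]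
    (hinv : ∀ g : G, MeasureTheory.MeasurePreserving (fun x : X => g • x) μ μ)
    {V : Set X} (hVm : MeasurableSet V) (hV : 0 < μ V) :
    ∃ F : Finset G, ∀ g : G, ∃ f ∈ F, ∃ z : X, g • z ∈ V ∧ f • z ∈ V := by
  by_contra! hF
  obtain ⟨u, -, hu⟩ := exists_seq_of_forall_finset_exists (fun _ : G => True)
    (fun f g : G => ∀ z : X, g • z ∈ V → f • z ∉ V)
    (fun s _ => (hF s).imp fun g hg => ⟨trivial, hg⟩)
  have hmeas (n : ℕ) : μ ((fun x : X => u n • x) ⁻¹' V) = μ V :=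
    (hinv (u n)).measure_preimage hVm.nullMeasurableSet
  obtain ⟨i, j, hij, z, hzi, hzj⟩ :=
    MeasureTheory.exists_nonempty_inter_of_measure_univ_lt_tsum_measure μ
      (s := fun n : ℕ => (fun x : X => u n • x) ⁻¹' V)
      (fun n => (hVm.preimage (hinv (u n)).measurable).nullMeasurableSet)
      (by simp only [hmeas]
          rw [ENNReal.tsum_const_eq_top_of_ne_zero hV.ne']
          exact MeasureTheory.measure_lt_top μ _)
  rcases lt_or_gt_of_ne hij with h | h
  · exact hu i j h z hzj hzi
  · exact hu j i h z hzi hzj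

/-- A non-sensitive transitive compact system with an invariant finite measure of full support is
minimal. -/
theorem dense_orbit_of_not_isSensitive
    {G X : Type*} [Group G] [MetricSpace X] [CompactSpace X]
    [MeasurableSpace X] [BorelSpace X] [MulAction G X]
    (hcont : ∀ g : G, Continuous fun x : X => g • x)
    (htrans : ∃ x : X, Dense (MulAction.orbit G x))
    (μ : MeasureTheory.Measure X) [MeasureTheory.IsFiniteMeasure μ]
    (hinv : ∀ g : G, MeasureTheory.MeasurePreserving (fun x : X => g • x) μ μ)
    (hfull : ∀ U : Set X, IsOpen U → U.Nonempty → 0 < μ U)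
    (hns : ¬ IsSensitive G X) (y : X) : Dense (MulAction.orbit G y) := by
  obtain ⟨x, hx⟩ := htrans
  rw [dense_iff_inter_open]
  intro U hUo hUne
  obtain ⟨_, hgU, g, rfl⟩ := hx.inter_open_nonempty U hUo hUne
  obtain ⟨ε, hε, hball⟩ := Metric.isOpen_iff.1 (hUo.preimage (hcont g)) x hgU
  obtain ⟨V, hVo, hxV, hV⟩ := exists_isOpen_forall_dist_smul_le_of_not_isSensitive hcont hns hx
    (ε := ε / 3) (by positivity)
  obtain ⟨F, hF⟩ := exists_finset_forall_exists_smul_mem μ hinv hVo.measurableSet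
    (hfull V hVo ⟨x, hxV⟩)
  have hN : IsOpen (⋂ f ∈ F, (fun z : X => f • z) ⁻¹' Metric.ball (f • y) (ε / 3)) :=
    isOpen_biInter_finset fun f _ => Metric.isOpen_ball.preimage (hcont f)
  obtain ⟨_, hhN, h, rfl⟩ := hx.inter_open_nonempty _ hN
    ⟨y, by simp [hε]⟩
  obtain ⟨f, hf, z, hhz, hfz⟩ := hF h⁻¹
  have h₁ : dist (f • h • x) (f • y) < ε / 3 := by
    simpa using Set.mem_iInter₂.1 hhN f hf
  have h₂ : dist (f • h • x) (f • z) ≤ ε / 3 := by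
    simpa [mul_smul] using hV (f * h) x hxV (h⁻¹ • z) hhz
  have h₃ : dist (f • z) x ≤ ε / 3 := by
    simpa using hV 1 (f • z) hfz x hxV
  have h₄ : dist (f • y) x < ε := by
    linarith [dist_triangle4 (f • y) (f • h • x) (f • z) x, dist_comm (f • y) (f • h • x)]
  exact ⟨g • f • y, hball h₄, g * f, mul_smul g f y⟩

/-- A non-sensitive minimal compact system is equicontinuous. -/
theorem isEqctsSys_of_not_isSensitive
    {G X : Type*} [Group G] [MetricSpace X] [CompactSpace X] [MulAction G X]
    (hcont : ∀ g : G, Continuous fun x : X => g • x) (hns : ¬ IsSensitive G X)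
    (hmin : ∀ x : X, Dense (MulAction.orbit G x)) : IsEqctsSys G X := by
  intro ε hε
  choose V hVo hxV hV using fun x : X =>
    exists_isOpen_forall_dist_smul_le_of_not_isSensitive hcont hns (hmin x) (half_pos hε)
  obtain ⟨δ, hδ, hball⟩ := lebesgue_number_lemma_of_metric isCompact_univ hVo
    fun x _ => Set.mem_iUnion.2 ⟨x, hxV x⟩
  refine ⟨δ, hδ, fun x y hxy g => ?_⟩
  obtain ⟨i, hi⟩ := hball x trivial
  exact (hV i g x (hi (Metric.mem_ball_self hδ)) y
    (hi (Metric.mem_ball'.2 hxy))).trans_lt (half_lt_self hε)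

/-- A transitive system carrying an invariant Borel probability measure of full support
is either minimal and equicontinuous, or sensitive. -/
theorem invariant_fullSupport_dichotomy
    {G X : Type*} [Group G] [Countable G] [MetricSpace X] [CompactSpace X]
    [MeasurableSpace X] [BorelSpace X] [MulAction G X]
    (hcont : ∀ g : G, Continuous fun x : X => g • x)
    (htrans : ∃ x : X, Dense (MulAction.orbit G x))
    (μ : MeasureTheory.Measure X) [MeasureTheory.IsProbabilityMeasure μ]
    (hinv : ∀ g : G, MeasureTheory.MeasurePreserving (fun x : X => g • x) μ μ)
    (hfull : ∀ U : Set X, IsOpen U → U.Nonempty → 0 < μ U) :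
    ((∀ x : X, Dense (MulAction.orbit G x)) ∧ IsEqctsSys G X) ∨ IsSensitive G X := by
  by_cases hns : IsSensitive G X
  · exact Or.inr hns
  · have hmin := dense_orbit_of_not_isSensitive hcont htrans μ hinv hfull hns
    exact Or.inl ⟨hmin, isEqctsSys_of_not_isSensitive hcont hns hmin⟩
end

section
/- Let (X,G) be a topological dynamical system and define the sensitivity constant s(x) := inf_{ε>0} sup{ diam(g·B_ε(x)) : g ∈ G }, where B_ε(x) is the open ε-ball around x. Then: (a) s is upper semicontinuous on X; (b) a point x is a sensitive point if and only if s(x) > 0; and (c) if (X,G) admits a G-invariant ergodic Borel probability measure of full support for which the set of sensitive points has positive measure, then (X,G) has sensitive dependence on initial conditions. -/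
/-- The sensitivity constant `s(x) = inf_{ε>0} sup_{g ∈ G} diam (g • B_ε(x))`. -/
noncomputable def sensConst (G : Type*) [Group G] {X : Type*} [MetricSpace X] [MulAction G X]
    (x : X) : ℝ :=
  sInf {r : ℝ | ∃ ε : ℝ, 0 < ε ∧
    r = ⨆ g : G, Metric.diam ((fun z : X => g • z) '' Metric.ball x ε)}

section SensConst

variable {G X : Type*} [Group G] [MetricSpace X] [MulAction G X]

lemma bddBelow_iSup_diam_ball (x : X) :
    BddBelow {r : ℝ | ∃ ε : ℝ, 0 < ε ∧
      r = ⨆ g : G, Metric.diam ((fun z : X => g • z) '' Metric.ball x ε)} := by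
  refine ⟨0, ?_⟩
  rintro r ⟨ε, -, rfl⟩
  exact Real.iSup_nonneg fun g => Metric.diam_nonneg

lemma diam_mono_of_compactSpace [CompactSpace X] {s t : Set X} (h : s ⊆ t) :
    Metric.diam s ≤ Metric.diam t :=
  Metric.diam_mono h Metric.isBounded_of_compactSpace

lemma bddAbove_diam_smul_image [CompactSpace X] (s : Set X) :
    BddAbove (Set.range fun g : G => Metric.diam ((fun z : X => g • z) '' s)) := by
  refine ⟨Metric.diam (Set.univ : Set X), ?_⟩
  rintro _ ⟨g, rfl⟩
  exact diam_mono_of_compactSpace (Set.subset_univ _)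

lemma sensConst_lt_iff {x : X} {c : ℝ} :
    sensConst G x < c ↔ ∃ ε : ℝ, 0 < ε ∧
      ⨆ g : G, Metric.diam ((fun z : X => g • z) '' Metric.ball x ε) < c := by
  rw [sensConst, csInf_lt_iff (bddBelow_iSup_diam_ball x) ⟨_, 1, one_pos, rfl⟩]
  constructor
  · rintro ⟨_, ⟨ε, hε, rfl⟩, h⟩
    exact ⟨ε, hε, h⟩
  · rintro ⟨ε, hε, h⟩
    exact ⟨_, ⟨ε, hε, rfl⟩, h⟩

lemma upperSemicontinuous_sensConst [CompactSpace X] :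
    UpperSemicontinuous (fun x : X => sensConst G x) := by
  intro x c hc
  obtain ⟨ε, hε, h⟩ := sensConst_lt_iff.1 hc
  filter_upwards [Metric.ball_mem_nhds x (half_pos hε)] with y hy
  refine sensConst_lt_iff.2 ⟨ε / 2, half_pos hε, lt_of_le_of_lt ?_ h⟩
  refine ciSup_mono (bddAbove_diam_smul_image _) fun g => ?_
  refine diam_mono_of_compactSpace (Set.image_mono (Metric.ball_subset_ball' ?_))
  rw [Metric.mem_ball] at hy
  linarith

lemma isEqctsPt_iff_sensConst_nonpos [CompactSpace X] {x : X} : IsEqctsPt G x ↔ sensConst G x ≤ 0 := by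
  constructor
  · intro h
    refine le_of_forall_pos_lt_add fun ε hε => ?_
    obtain ⟨δ, hδ, hd⟩ := h (ε / 3) (by positivity)
    refine sensConst_lt_iff.2 ⟨δ, hδ, lt_of_le_of_lt (b := 2 * (ε / 3)) ?_ (by linarith)⟩
    refine ciSup_le fun g => Metric.diam_le_of_forall_dist_le (by positivity) ?_
    rintro _ ⟨y, hy, rfl⟩ _ ⟨z, hz, rfl⟩
    have hxy := hd y (Metric.mem_ball'.1 hy) g
    have hxz := hd z (Metric.mem_ball'.1 hz) g
    have := dist_triangle_left (g • y) (g • z) (g • x)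
    simp only
    linarith
  · intro h ε hε
    obtain ⟨δ, hδ, hd⟩ := sensConst_lt_iff.1 (h.trans_lt hε)
    refine ⟨δ, hδ, fun y hy g => lt_of_le_of_lt ?_ hd⟩
    exact (Metric.dist_le_diam_of_mem Metric.isBounded_of_compactSpace
      (Set.mem_image_of_mem (fun z : X => g • z) (Metric.mem_ball_self hδ))
      (Set.mem_image_of_mem (fun z : X => g • z) (Metric.mem_ball'.2 hy))).trans
      (le_ciSup (bddAbove_diam_smul_image (G := G) (Metric.ball x δ)) g)

lemma sensConst_smul_le [CompactSpace X] (hcont : ∀ g : G, Continuous fun x : X => g • x) (g : G) (x : X) :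
    sensConst G (g • x) ≤ sensConst G x := by
  refine le_of_forall_gt fun c hc => ?_
  obtain ⟨ε, hε, h⟩ := sensConst_lt_iff.1 hc
  obtain ⟨δ, hδ, hsub⟩ := Metric.continuousAt_iff.1 (hcont g⁻¹).continuousAt ε hε
  refine sensConst_lt_iff.2 ⟨δ, hδ, lt_of_le_of_lt ?_ h⟩
  refine ciSup_le fun k => le_trans ?_ (le_ciSup (bddAbove_diam_smul_image _) (k * g))
  refine diam_mono_of_compactSpace ?_
  rintro _ ⟨y, hy, rfl⟩
  refine ⟨g⁻¹ • y, ?_, by simp [mul_smul]⟩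
  simpa using hsub (Metric.mem_ball.1 hy)

lemma sensConst_smul [CompactSpace X] (hcont : ∀ g : G, Continuous fun x : X => g • x) (g : G) (x : X) :
    sensConst G (g • x) = sensConst G x := by
  refine le_antisymm (sensConst_smul_le hcont g x) ?_
  simpa using sensConst_smul_le hcont g⁻¹ (g • x)

lemma isSensitive_of_forall_le_sensConst [CompactSpace X] {c : ℝ} (hc : 0 < c)
    (h : ∀ x : X, c ≤ sensConst G x) : IsSensitive G X := by
  refine ⟨c / 2, half_pos hc, fun U hU ⟨x, hx⟩ => ?_⟩
  obtain ⟨ε, hε, hsub⟩ := Metric.isOpen_iff.1 hU x hx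
  have hlt : c / 2 < ⨆ g : G, Metric.diam ((fun z : X => g • z) '' Metric.ball x ε) :=
    (half_lt_self hc).trans_le <|
      (h x).trans <| csInf_le (bddBelow_iSup_diam_ball x) ⟨ε, hε, rfl⟩
  obtain ⟨g, hg⟩ := exists_lt_of_lt_ciSup hlt
  exact ⟨g, hg.trans_le (diam_mono_of_compactSpace (Set.image_mono hsub))⟩

end SensConst

/-- (a) `s` is upper semicontinuous; (b) `x` is a sensitive point iff `s(x) > 0`;
(c) if there is an invariant ergodic Borel probability measure of full support giving the
set of sensitive points positive measure, then the system is sensitive. -/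
theorem sensConst_properties
    {G X : Type*} [Group G] [MetricSpace X] [CompactSpace X]
    [MeasurableSpace X] [BorelSpace X] [MulAction G X]
    (hcont : ∀ g : G, Continuous fun x : X => g • x) :
    UpperSemicontinuous (fun x : X => sensConst G x) ∧
    (∀ x : X, ¬ IsEqctsPt G x ↔ 0 < sensConst G x) ∧
    ((∃ μ : MeasureTheory.Measure X, MeasureTheory.IsProbabilityMeasure μ ∧
        (∀ g : G, MeasureTheory.MeasurePreserving (fun x : X => g • x) μ μ) ∧
        (∀ s : Set X, MeasurableSet s →
          (∀ g : G, (fun x : X => g • x) ⁻¹' s = s) → μ s = 0 ∨ μ s = 1) ∧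
        (∀ U : Set X, IsOpen U → U.Nonempty → 0 < μ U) ∧
        0 < μ {x : X | ¬ IsEqctsPt G x}) → IsSensitive G X) := by
  refine ⟨upperSemicontinuous_sensConst, fun x => ?_, ?_⟩
  · rw [isEqctsPt_iff_sensConst_nonpos, not_le]
  rintro ⟨μ, hμ, -, herg, hfull, hpos⟩
  have hclosed (c : ℝ) : IsClosed {x : X | c ≤ sensConst G x} :=
    upperSemicontinuous_sensConst.isClosed_preimage c
  obtain ⟨n, hn⟩ : ∃ n : ℕ, μ {x : X | 1 / ((n : ℝ) + 1) ≤ sensConst G x} ≠ 0 := by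
    by_contra! h
    refine hpos.ne' (MeasureTheory.measure_mono_null ?_ (MeasureTheory.measure_iUnion_null h))
    intro x hx
    rw [Set.mem_ofPred_eq, isEqctsPt_iff_sensConst_nonpos, not_le] at hx
    obtain ⟨n, hn⟩ := exists_nat_one_div_lt hx
    exact Set.mem_iUnion.2 ⟨n, hn.le⟩
  have hone := (herg _ (hclosed (1 / ((n : ℝ) + 1))).measurableSet fun g => by
    ext x; simp [sensConst_smul hcont]).resolve_left hn
  refine isSensitive_of_forall_le_sensConst (c := 1 / ((n : ℝ) + 1)) (by positivity) ?_
  by_contra! h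
  refine (hfull _ (hclosed (1 / ((n : ℝ) + 1))).isOpen_compl ?_).ne' ?_
  · obtain ⟨x, hx⟩ := h
    exact ⟨x, not_le.2 hx⟩
  · exact (MeasureTheory.prob_compl_eq_zero_iff (hclosed _).measurableSet).2 hone
end
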